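/- arXiv:1705.04791 — 2 statements merged into one kernel-verified Lean document; each statement's English description precedes it below -/
import Mathlib

section
/- Let λ = (λ_1 ≥ ⋯ ≥ λ_r > 0) be a partition of length r ≤ n and define the factorial Hall–Littlewood P-polynomial HP_λ(x_n;t|b) := Σ_{w∈C(r,n)} w·( ∏_{i=1}^{r} ∏_{j=1}^{λ_i} (x_i + b_j) · ∏_{i=1}^{r} ∏_{j=i+1}^{n} (x_i − t x_j)/(x_i − x_j) ). Then HP_λ(x_n;t|b) = [u_1^{−λ_1}⋯u_r^{−λ_r}]( (1−t)^{−r} ∏_{i=1}^{r} ( ∏_{j=1}^{n} (u_i − t x_j)/(u_i − x_j) · ∏_{j=1}^{i−1} (u_i − u_j)/(u_i − t u_j) − t^{n−i+1} ) · ∏_{i=1}^{r} ∏_{j=1}^{λ_i} (u_i + b_j)/u_i ), the coefficient being taken in Λ. This is the additive specialization of the generating-function theorem for the universal factorial Hall–Littlewood P-functions. -/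
open Finset

noncomputable section

instance finWF (r : ℕ) : WellFoundedLT (Fin r) :=
  inferInstanceAs (IsWellFounded (Fin r) (· < ·))

/-- The field `ℚ(x_1, …, x_n, b_1, b_2, …, t)` of rational functions. -/
abbrev K (n : ℕ) : Type := FractionRing (MvPolynomial (Fin n ⊕ ℕ ⊕ Unit) ℚ)

/-- The indeterminate `x_i` (`0`-indexed). -/
def x (n : ℕ) (i : Fin n) : K n :=
  algebraMap (MvPolynomial (Fin n ⊕ ℕ ⊕ Unit) ℚ) (K n) (MvPolynomial.X (Sum.inl i))

/-- The indeterminate `b_{j+1}` (so `b 0 = b_1`, …). -/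
def b (n : ℕ) (j : ℕ) : K n :=
  algebraMap (MvPolynomial (Fin n ⊕ ℕ ⊕ Unit) ℚ) (K n) (MvPolynomial.X (Sum.inr (Sum.inl j)))

/-- The indeterminate `t`. -/
def t (n : ℕ) : K n :=
  algebraMap (MvPolynomial (Fin n ⊕ ℕ ⊕ Unit) ℚ) (K n) (MvPolynomial.X (Sum.inr (Sum.inr ())))

/-- The coset representatives `C(r,n)`. -/
def Cperm (r n : ℕ) : Finset (Equiv.Perm (Fin n)) :=
  Finset.univ.filter fun w => ∀ i j : Fin n, r ≤ (i : ℕ) → i < j → w i < w j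

/-- The iterated formal Laurent series field `Λ = K((u_1⁻¹))⋯((u_r⁻¹))`, realized inside the
Hahn series field over the lexicographically ordered group `ℤ^r`. -/
abbrev H (n r : ℕ) := HahnSeries (Lex (Fin r → ℤ)) (K n)

/-- The variable `u_i` (`0`-indexed). -/
def u (n r : ℕ) (i : Fin r) : H n r :=
  HahnSeries.single (toLex (Pi.single (Fin.rev i) (-1 : ℤ))) 1

open Polynomial in
/-- Partial fractions at the nodes `x i`, evaluated at `0`. -/
theorem sum_eval_mul_prod_div_eq_coeff_divByMonic {F ι : Type*} [Field F] [DecidableEq ι]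
    (S : Finset ι) (x : ι → F) (t : F) (hx : Set.InjOn x S) (hx0 : ∀ i ∈ S, x i ≠ 0)
    (ht : 1 - t ≠ 0) (p : F[X]) :
    ∑ i ∈ S, p.eval (x i) * ∏ j ∈ S.erase i, (x i - t * x j) / (x i - x j) =
      (1 - t)⁻¹ * (((p * ∏ j ∈ S, (X - C (t * x j))) /ₘ ∏ j ∈ S, (X - C (x j))).coeff 0 -
        t ^ #S * p.coeff 0) := by
  set N : F[X] := ∏ j ∈ S, (X - C (t * x j)) with hN
  set D : F[X] := ∏ j ∈ S, (X - C (x j)) with hD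
  have hmonic : D.Monic := monic_prod_of_monic _ _ fun j _ => monic_X_sub_C _
  have hdeg : D.degree = #S := by
    rw [hD, degree_prod]; simp
  have hD0 : D.eval 0 ≠ 0 := by
    simp only [hD, eval_prod, eval_sub, eval_X, eval_C, zero_sub]
    exact Finset.prod_ne_zero_iff.2 fun i hi => neg_ne_zero.2 (hx0 i hi)
  have hN0 : N.eval 0 = t ^ #S * D.eval 0 := by
    simp only [hD, hN, eval_prod, eval_sub, eval_X, eval_C, zero_sub]
    rw [← Finset.prod_const, ← Finset.prod_mul_distrib]
    exact Finset.prod_congr rfl fun i _ => by ring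
  have hrem : (p * N) %ₘ D = Lagrange.interpolate S x fun i => (p * N).eval (x i) := by
    refine Lagrange.eq_interpolate_of_eval_eq _ hx ?_ fun i hi => ?_
    · rw [← hdeg]; exact degree_modByMonic_lt _ hmonic
    · have h0 : D.eval (x i) = 0 := by
        rw [hD, eval_prod]
        exact Finset.prod_eq_zero hi (by simp)
      conv_rhs => rw [← modByMonic_add_div (p * N) D]
      simp [h0]
  have key := congrArg (eval 0) (modByMonic_add_div (p * N) D)
  rw [hrem, Lagrange.interpolate_apply, eval_add, eval_finsetSum] at key
  simp only [eval_mul, eval_C, hN0] at key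
  rw [coeff_zero_eq_eval_zero, coeff_zero_eq_eval_zero, eq_inv_mul_iff_mul_eq₀ ht,
    ← mul_left_inj' hD0]
  have hsum : ∑ i ∈ S, p.eval (x i) * N.eval (x i) * (Lagrange.basis S x i).eval 0 =
      -((1 - t) * ∑ i ∈ S, p.eval (x i) *
        ∏ j ∈ S.erase i, (x i - t * x j) / (x i - x j)) * D.eval 0 := by
    rw [Finset.mul_sum, ← Finset.sum_neg_distrib, Finset.sum_mul]
    refine Finset.sum_congr rfl fun i hi => ?_
    have h1 : N.eval (x i) = (x i - t * x i) * ∏ j ∈ S.erase i, (x i - t * x j) := by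
      rw [hN, eval_prod, ← Finset.mul_prod_erase _ _ hi]; simp
    have h2 : D.eval 0 = -x i * ∏ j ∈ S.erase i, (0 - x j) := by
      rw [hD, eval_prod, ← Finset.mul_prod_erase _ _ hi]; simp
    have h3 : (Lagrange.basis S x i).eval 0 =
        (∏ j ∈ S.erase i, (0 - x j)) / ∏ j ∈ S.erase i, (x i - x j) := by
      simp [Lagrange.basis, Lagrange.basisDivisor, eval_prod, Finset.prod_mul_distrib,
        div_eq_inv_mul]
    rw [h1, h2, h3, Finset.prod_div_distrib]
    ring
  rw [hsum] at key
  linear_combination -key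

theorem Polynomial.mul_divByMonic_mul_left {R : Type*} [CommRing R] {e d : Polynomial R}
    (he : e.Monic) (hd : d.Monic) (p : Polynomial R) : (e * p) /ₘ (e * d) = p /ₘ d := by
  nontriviality R
  refine (Polynomial.div_modByMonic_unique _ (e * (p %ₘ d)) (he.mul hd) ⟨?_, ?_⟩).1
  · rw [mul_assoc, ← mul_add, Polynomial.modByMonic_add_div]
  · rw [mul_comm e, mul_comm e, he.degree_mul, he.degree_mul]
    rw [Polynomial.degree_eq_natDegree he.ne_zero]
    exact WithBot.add_lt_add_right (WithBot.coe_ne_bot) (Polynomial.degree_modByMonic_lt _ hd)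

theorem Polynomial.smul_divByMonic {R : Type*} [CommRing R] {q : Polynomial R} (hq : q.Monic)
    (c : R) (p : Polynomial R) : c • p /ₘ q = c • (p /ₘ q) := by
  nontriviality R
  exact (Polynomial.div_modByMonic_unique (c • (p /ₘ q)) (c • (p %ₘ q)) hq
    ⟨by rw [mul_smul_comm, ← smul_add, Polynomial.modByMonic_add_div],
      (Polynomial.degree_smul_le _ _).trans_lt (Polynomial.degree_modByMonic_lt _ hq)⟩).1

section IteratedLaurent

variable {F : Type*} [Field F]

theorem Lex.apply_zero_le {r : ℕ} {a b : Lex (Fin (r + 1) → ℤ)} (h : a ≤ b) :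
    ofLex a 0 ≤ ofLex b 0 := by
  rcases h.eq_or_lt with rfl | ⟨i, hi, hlt⟩
  · exact le_rfl
  · rcases eq_or_ne i 0 with rfl | h0
    · exact hlt.le
    · exact (hi 0 (Fin.pos_iff_ne_zero.2 h0)).le

/-- Prepending a zero, as a homomorphism of lexicographic powers of `ℤ`. -/
def lexConsZero (r : ℕ) : Lex (Fin r → ℤ) →+ Lex (Fin (r + 1) → ℤ) where
  toFun a := toLex (Fin.cons 0 (ofLex a))
  map_zero' := by
    refine congrArg toLex (funext fun i => ?_)
    cases i using Fin.cases <;> rfl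
  map_add' a b := by
    refine congrArg toLex (funext fun i => ?_)
    cases i using Fin.cases <;> rfl

theorem lexConsZero_strictMono (r : ℕ) : StrictMono (lexConsZero r) := by
  rintro a b ⟨i, hi, hlt⟩
  refine ⟨i.succ, fun j hj => ?_, hlt⟩
  cases j using Fin.cases with
  | zero => rfl
  | succ j => exact hi j (Fin.succ_lt_succ_iff.1 hj)

/-- Laurent series in the variables of positions `1, …, r`, seen as Laurent series in the
variables of positions `0, …, r`. -/
def lexEmb (F : Type*) [Field F] (r : ℕ) :
    HahnSeries (Lex (Fin r → ℤ)) F →+* HahnSeries (Lex (Fin (r + 1) → ℤ)) F :=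
  HahnSeries.embDomainRingHom (lexConsZero r) (lexConsZero_strictMono r).injective
    fun _ _ => (lexConsZero_strictMono r).le_iff_le

theorem lexEmb_coeff_zero {r : ℕ} (y : HahnSeries (Lex (Fin r → ℤ)) F) :
    (lexEmb F r y).coeff 0 = y.coeff 0 := by
  rw [← (lexConsZero r).map_zero]
  exact HahnSeries.embDomain_coeff (f := ⟨⟨lexConsZero r, _⟩, _⟩)

theorem lexEmb_coeff_eq_zero {r : ℕ} (y : HahnSeries (Lex (Fin r → ℤ)) F)
    {a : Lex (Fin (r + 1) → ℤ)} (ha : ofLex a 0 ≠ 0) : (lexEmb F r y).coeff a = 0 := by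
  refine HahnSeries.embDomain_of_notMem_range ?_
  rintro ⟨c, rfl⟩
  exact ha rfl

theorem lexEmb_C {r : ℕ} (c : F) : lexEmb F r (HahnSeries.C c) = HahnSeries.C c :=
  HahnSeries.embDomainRingHom_C

/-- The inverse of the infinitesimal of position `k`. -/
def lexVar (F : Type*) [Field F] (r : ℕ) (k : Fin r) : HahnSeries (Lex (Fin r → ℤ)) F :=
  HahnSeries.single (toLex (Pi.single k (-1 : ℤ))) 1

theorem lexEmb_lexVar {r : ℕ} (k : Fin r) : lexEmb F r (lexVar F r k) = lexVar F (r + 1) k.succ := by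
  refine HahnSeries.embDomain_single.trans ?_
  refine congrArg (fun a => HahnSeries.single a (1 : F)) (congrArg toLex (funext fun i => ?_))
  cases i using Fin.cases with
  | zero => simp
  | succ i => simp [Pi.single_apply]

theorem lexVar_pow {r : ℕ} (k : Fin r) (m : ℕ) :
    lexVar F r k ^ m = HahnSeries.single (toLex (Pi.single k (-m : ℤ))) 1 := by
  rw [lexVar, HahnSeries.single_pow, one_pow]
  refine congrArg (fun a => HahnSeries.single a (1 : F)) ?_
  change m • (Pi.single k (-1) : Fin r → ℤ) = Pi.single k (-m : ℤ)
  rw [← Pi.single_smul]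
  simp

/-- Evaluation at the variable of position `0`. -/
def lexEval (F : Type*) [Field F] (r : ℕ) :
    Polynomial (HahnSeries (Lex (Fin r → ℤ)) F) →+* HahnSeries (Lex (Fin (r + 1) → ℤ)) F :=
  Polynomial.eval₂RingHom (lexEmb F r) (lexVar F (r + 1) 0)

theorem ofLex_sub_toLex_single_apply_zero {r : ℕ} (a : Lex (Fin (r + 1) → ℤ)) (m : ℤ) :
    ofLex (a - (toLex (Pi.single 0 m) : Lex (Fin (r + 1) → ℤ))) 0 = ofLex a 0 - m :=
  congrArg (ofLex a 0 - ·) (Pi.single_eq_same (M := fun _ => ℤ) (0 : Fin (r + 1)) m)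

theorem lexEval_coeff {r : ℕ} (p : Polynomial (HahnSeries (Lex (Fin r → ℤ)) F))
    (a : Lex (Fin (r + 1) → ℤ)) :
    (lexEval F r p).coeff a =
      ∑ k ∈ range (p.natDegree + 1),
        (lexEmb F r (p.coeff k)).coeff (a - toLex (Pi.single 0 (-k : ℤ))) := by
  rw [lexEval, Polynomial.coe_eval₂RingHom, Polynomial.eval₂_eq_sum_range, HahnSeries.coeff_sum]
  refine Finset.sum_congr rfl fun k _ => ?_
  rw [lexVar_pow, HahnSeries.coeff_mul_single, mul_one]

theorem lexEval_coeff_zero {r : ℕ} (p : Polynomial (HahnSeries (Lex (Fin r → ℤ)) F)) :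
    (lexEval F r p).coeff 0 = (p.coeff 0).coeff 0 := by
  rw [lexEval_coeff, Finset.sum_eq_single 0]
  · simp [lexEmb_coeff_zero]
  · intro k _ hk
    refine lexEmb_coeff_eq_zero _ ?_
    rw [ofLex_sub_toLex_single_apply_zero]
    change (0 : ℤ) - -k ≠ 0
    omega
  · simp

theorem neg_natDegree_le_of_lexEval_coeff_ne_zero {r : ℕ}
    {p : Polynomial (HahnSeries (Lex (Fin r → ℤ)) F)} {a : Lex (Fin (r + 1) → ℤ)}
    (h : (lexEval F r p).coeff a ≠ 0) : -(p.natDegree : ℤ) ≤ ofLex a 0 := by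
  rw [lexEval_coeff] at h
  obtain ⟨k, hk, hne⟩ := Finset.exists_ne_zero_of_sum_ne_zero h
  have := not_imp_comm.1 (lexEmb_coeff_eq_zero _) hne
  have hk' := Finset.mem_range.1 hk
  rw [ofLex_sub_toLex_single_apply_zero] at this
  omega

theorem lexEval_coeff_natDegree {r : ℕ} {p : Polynomial (HahnSeries (Lex (Fin r → ℤ)) F)}
    (hp : p.Monic) :
    (lexEval F r p).coeff (toLex (Pi.single 0 (-(p.natDegree : ℤ)))) = 1 := by
  rw [lexEval_coeff, Finset.sum_eq_single p.natDegree]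
  · rw [sub_self, lexEmb_coeff_zero, hp.coeff_natDegree]
    simp
  · intro k _ hk
    refine lexEmb_coeff_eq_zero _ ?_
    rw [ofLex_sub_toLex_single_apply_zero, ofLex_toLex, Pi.single_eq_same]
    omega
  · simp

theorem lexEval_ne_zero {r : ℕ} {p : Polynomial (HahnSeries (Lex (Fin r → ℤ)) F)}
    (hp : p.Monic) : lexEval F r p ≠ 0 := by
  intro h
  simpa [h] using lexEval_coeff_natDegree hp

theorem lexEval_div_coeff_zero_of_degree_lt {r : ℕ}
    {p d : Polynomial (HahnSeries (Lex (Fin r → ℤ)) F)} (hd : d.Monic)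
    (h : p.degree < d.degree) : (lexEval F r p / lexEval F r d).coeff 0 = 0 := by
  set z := lexEval F r p / lexEval F r d with hz
  rcases eq_or_ne z 0 with h0 | h0
  · simp [h0]
  have hd0 := lexEval_ne_zero hd
  have hmul : z * lexEval F r d = lexEval F r p := div_mul_cancel₀ _ hd0
  have hp0 : lexEval F r p ≠ 0 := hmul ▸ mul_ne_zero h0 hd0
  have hp : p ≠ 0 := by rintro rfl; simp at hp0
  have hord : z.order + (lexEval F r d).order = (lexEval F r p).order := by
    rw [← hmul, HahnSeries.order_mul h0 hd0]
  have h1 : ofLex (lexEval F r d).order 0 ≤ -(d.natDegree : ℤ) := by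
    have := Lex.apply_zero_le (HahnSeries.order_le_of_coeff_ne_zero
      (by rw [lexEval_coeff_natDegree hd]; exact one_ne_zero))
    simpa using this
  have h2 := neg_natDegree_le_of_lexEval_coeff_ne_zero
    (mt HahnSeries.coeff_order_eq_zero.1 hp0)
  have h3 := Polynomial.natDegree_lt_natDegree hp h
  have h4 : ofLex z.order 0 + ofLex (lexEval F r d).order 0 = ofLex (lexEval F r p).order 0 := by
    rw [← hord]; rfl
  refine HahnSeries.coeff_eq_zero_of_lt_order (lt_of_not_ge fun hle => ?_)
  have h5 : ofLex z.order 0 ≤ 0 := Lex.apply_zero_le hle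
  omega

/-- Extracting the constant coefficient of a fraction amounts to polynomial division. -/
theorem lexEval_div_coeff_zero {r : ℕ} (p : Polynomial (HahnSeries (Lex (Fin r → ℤ)) F))
    {d : Polynomial (HahnSeries (Lex (Fin r → ℤ)) F)} (hd : d.Monic) :
    (lexEval F r p / lexEval F r d).coeff 0 = ((p /ₘ d).coeff 0).coeff 0 := by
  have hd0 := lexEval_ne_zero hd
  have : lexEval F r p / lexEval F r d =
      lexEval F r (p %ₘ d) / lexEval F r d + lexEval F r (p /ₘ d) := by
    rw [div_add' _ _ _ hd0, ← map_mul, ← map_add, mul_comm (p /ₘ d),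
      Polynomial.modByMonic_add_div]
  rw [this, HahnSeries.coeff_add, lexEval_coeff_zero,
    lexEval_div_coeff_zero_of_degree_lt hd (Polynomial.degree_modByMonic_lt _ hd), zero_add]

end IteratedLaurent

section HallLittlewood

variable {F : Type*} [Field F]

/-- A polynomial in the variables of positions `0, …, r - 1`, seen as a Laurent series. -/
def lexPoly (F : Type*) [Field F] (r : ℕ) :
    MvPolynomial (Fin r) F →+* HahnSeries (Lex (Fin r → ℤ)) F :=
  MvPolynomial.eval₂Hom HahnSeries.C (lexVar F r)

theorem lexPoly_succ {r : ℕ} (p : MvPolynomial (Fin (r + 1)) F) :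
    lexPoly F (r + 1) p = lexEval F r ((MvPolynomial.finSuccEquiv F r p).map (lexPoly F r)) := by
  suffices h : lexPoly F (r + 1) = ((lexEval F r).comp (Polynomial.mapRingHom (lexPoly F r))).comp
      (MvPolynomial.finSuccEquiv F r : MvPolynomial (Fin (r + 1)) F →+* _) from
    congrArg (fun f => f p) h
  refine MvPolynomial.ringHom_ext (fun c => ?_) fun i => ?_
  · simp [lexPoly, lexEval, MvPolynomial.finSuccEquiv_apply, lexEmb_C, -HahnSeries.C_apply]
  · cases i using Fin.cases with
    | zero => simp [lexPoly, lexEval, MvPolynomial.finSuccEquiv_X_zero]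
    | succ i => simp [lexPoly, lexEval, MvPolynomial.finSuccEquiv_X_succ, lexEmb_lexVar]

/-- The factor of position `k` of the Hall–Littlewood generating function. -/
def hallLittlewoodFactor {n : ℕ} (x : Fin n → F) (t : F) (r : ℕ) (k : Fin r) :
    HahnSeries (Lex (Fin r → ℤ)) F :=
  (∏ j, (lexVar F r k - HahnSeries.C t * HahnSeries.C (x j)) /
      (lexVar F r k - HahnSeries.C (x j))) *
    (∏ l ∈ Ioi k, (lexVar F r k - lexVar F r l) /
      (lexVar F r k - HahnSeries.C t * lexVar F r l)) -
    HahnSeries.C t ^ (n - (Fin.rev k : ℕ))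

theorem lexEmb_hallLittlewoodFactor {n : ℕ} (x : Fin n → F) (t : F) {r : ℕ} (k : Fin r) :
    lexEmb F r (hallLittlewoodFactor x t r k) = hallLittlewoodFactor x t (r + 1) k.succ := by
  simp only [hallLittlewoodFactor, map_sub, map_mul, map_prod, map_pow, map_div₀, lexEmb_C,
    lexEmb_lexVar, Fin.prod_Ioi_succ, Fin.rev_succ, Fin.val_castSucc]

/-- The numerator of the factor of position `0`, without its last term. -/
def hallLittlewoodNum {n : ℕ} (x : Fin n → F) (t : F) (r : ℕ) :
    Polynomial (MvPolynomial (Fin r) F) :=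
  (∏ j, (Polynomial.X - Polynomial.C (MvPolynomial.C (t * x j)))) *
    ∏ l, (Polynomial.X - Polynomial.C (MvPolynomial.X l))

/-- The denominator of the factor of position `0`. -/
def hallLittlewoodDen {n : ℕ} (x : Fin n → F) (t : F) (r : ℕ) :
    Polynomial (MvPolynomial (Fin r) F) :=
  (∏ j, (Polynomial.X - Polynomial.C (MvPolynomial.C (x j)))) *
    ∏ l, (Polynomial.X - Polynomial.C (MvPolynomial.C t * MvPolynomial.X l))

theorem hallLittlewoodDen_monic {n : ℕ} (x : Fin n → F) (t : F) (r : ℕ) :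
    (hallLittlewoodDen x t r).Monic :=
  (Polynomial.monic_prod_of_monic _ _ fun _ _ => Polynomial.monic_X_sub_C _).mul
    (Polynomial.monic_prod_of_monic _ _ fun _ _ => Polynomial.monic_X_sub_C _)

theorem hallLittlewoodFactor_zero {n : ℕ} (x : Fin n → F) (t : F) (r : ℕ) :
    hallLittlewoodFactor x t (r + 1) 0 =
      lexEval F r ((hallLittlewoodNum x t r).map (lexPoly F r)) /
        lexEval F r ((hallLittlewoodDen x t r).map (lexPoly F r)) - HahnSeries.C t ^ (n - r) := by
  have hX : lexEval F r Polynomial.X = lexVar F (r + 1) 0 := by simp [lexEval]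
  have hC (c : HahnSeries (Lex (Fin r → ℤ)) F) : lexEval F r (Polynomial.C c) = lexEmb F r c := by
    simp [lexEval]
  have hPC (c : F) : lexPoly F r (MvPolynomial.C c) = HahnSeries.C c := by
    simp [lexPoly, -HahnSeries.C_apply]
  have hPX (l : Fin r) : lexPoly F r (MvPolynomial.X l) = lexVar F r l := by simp [lexPoly]
  simp only [hallLittlewoodFactor, hallLittlewoodNum, hallLittlewoodDen, Polynomial.map_mul,
    Polynomial.map_prod, Polynomial.map_sub, Polynomial.map_X, Polynomial.map_C, map_mul,
    map_prod, map_sub, hX, hC, hPC, hPX, lexEmb_C, lexEmb_lexVar, Fin.prod_Ioi_zero,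
    Finset.prod_div_distrib, mul_div_mul_comm, Fin.rev_zero, Fin.val_last]

theorem coeff_zero_lexPoly_mul_prod_succ {n : ℕ} (x : Fin n → F) (t : F) {r : ℕ}
    (p : MvPolynomial (Fin (r + 1)) F) :
    (lexPoly F (r + 1) p * ∏ k, hallLittlewoodFactor x t (r + 1) k).coeff 0 =
      (lexPoly F r
        (((MvPolynomial.finSuccEquiv F r p * hallLittlewoodNum x t r) /ₘ
            hallLittlewoodDen x t r).coeff 0 -
          MvPolynomial.C (t ^ (n - r)) * (MvPolynomial.finSuccEquiv F r p).coeff 0) *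
        ∏ k, hallLittlewoodFactor x t r k).coeff 0 := by
  set y := ∏ k, hallLittlewoodFactor x t r k with hy
  set q := MvPolynomial.finSuccEquiv F r p with hq
  have hC (c : HahnSeries (Lex (Fin r → ℤ)) F) : lexEmb F r c = lexEval F r (Polynomial.C c) := by
    simp [lexEval]
  have hprod : ∏ k, hallLittlewoodFactor x t (r + 1) k =
      hallLittlewoodFactor x t (r + 1) 0 * lexEval F r (Polynomial.C y) := by
    rw [Fin.prod_univ_succ, ← hC, hy, map_prod]
    simp only [lexEmb_hallLittlewoodFactor]
  have hCt : (HahnSeries.C t : HahnSeries (Lex (Fin (r + 1) → ℤ)) F) ^ (n - r) =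
      lexEval F r (Polynomial.C (HahnSeries.C (t ^ (n - r)))) := by
    rw [← hC, lexEmb_C, map_pow]
  have hlp : lexPoly F r (MvPolynomial.C (t ^ (n - r))) = HahnSeries.C (t ^ (n - r)) := by
    simp [lexPoly]
  set N := (hallLittlewoodNum x t r).map (lexPoly F r) with hN
  set D := (hallLittlewoodDen x t r).map (lexPoly F r) with hD
  have hDm : D.Monic := (hallLittlewoodDen_monic x t r).map _
  have : lexPoly F (r + 1) p * ∏ k, hallLittlewoodFactor x t (r + 1) k =
      lexEval F r (y • (q.map (lexPoly F r) * N)) / lexEval F r D -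
        lexEval F r ((HahnSeries.C (t ^ (n - r)) * y) • q.map (lexPoly F r)) := by
    rw [hprod, hallLittlewoodFactor_zero, lexPoly_succ, hCt, Polynomial.smul_eq_C_mul,
      Polynomial.smul_eq_C_mul]
    simp only [map_mul]
    ring
  rw [this, HahnSeries.coeff_sub, lexEval_div_coeff_zero _ hDm, lexEval_coeff_zero,
    Polynomial.smul_divByMonic hDm, hN, hD, ← Polynomial.map_mul,
    ← Polynomial.map_divByMonic _ (hallLittlewoodDen_monic x t r), Polynomial.coeff_smul,
    Polynomial.coeff_smul, Polynomial.coeff_map, Polynomial.coeff_map, map_sub, map_mul, hlp,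
    ← HahnSeries.coeff_sub]
  congr 1
  simp only [smul_eq_mul]
  ring

/-- The product of the ratios `(x i - t x j) / (x i - x j)` attached to a choice of `r` of the
variables `x`. -/
def hallLittlewoodTerm {n : ℕ} (x : Fin n → F) (t : F) {r : ℕ} (w : Fin r ↪ Fin n) : F :=
  ∏ k, ∏ j ∈ ((Ici k).map w)ᶜ, (x (w k) - t * x j) / (x (w k) - x j)

theorem hallLittlewoodTerm_succ {n : ℕ} (x : Fin n → F) (t : F) {r : ℕ} (w : Fin r ↪ Fin n)
    (i : Fin n) (hi : i ∉ Set.range w) :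
    hallLittlewoodTerm x t ((Equiv.embeddingFinSucc r (Fin n)).symm ⟨w, i, hi⟩) =
      (∏ j ∈ ((univ.map w)ᶜ).erase i, (x i - t * x j) / (x i - x j)) *
        hallLittlewoodTerm x t w := by
  rw [hallLittlewoodTerm, Fin.prod_univ_succ]
  congr 1
  · simp only [Equiv.coe_embeddingFinSucc_symm, Fin.cons_zero]
    refine Finset.prod_congr ?_ fun _ _ => rfl
    ext j
    simp [Fin.exists_fin_succ, eq_comm]
  · refine Finset.prod_congr rfl fun k _ => ?_
    simp only [Equiv.coe_embeddingFinSucc_symm, Fin.cons_succ]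
    refine Finset.prod_congr ?_ fun _ _ => rfl
    ext j
    simp [Fin.exists_fin_succ]

theorem eval_coeff_divByMonic_eq_sum {n : ℕ} (x : Fin n → F) (t : F) (hx : Function.Injective x)
    (hx0 : ∀ i, x i ≠ 0) (ht : 1 - t ≠ 0) {r : ℕ} (w : Fin r ↪ Fin n)
    (q : Polynomial (MvPolynomial (Fin r) F)) :
    MvPolynomial.eval (x ∘ w)
        (((q * hallLittlewoodNum x t r) /ₘ hallLittlewoodDen x t r).coeff 0 -
          MvPolynomial.C (t ^ (n - r)) * q.coeff 0) =
      (1 - t) * ∑ i ∈ (univ.map w)ᶜ, (q.map (MvPolynomial.eval (x ∘ w))).eval (x i) *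
        ∏ j ∈ ((univ.map w)ᶜ).erase i, (x i - t * x j) / (x i - x j) := by
  set S := (univ.map w)ᶜ with hS
  have hcard : #S = n - r := by simp [hS, Finset.card_compl]
  set e : Polynomial F := (∏ l, (Polynomial.X - Polynomial.C (x (w l)))) *
    ∏ l, (Polynomial.X - Polynomial.C (t * x (w l))) with he
  have hem : e.Monic :=
    (Polynomial.monic_prod_of_monic _ _ fun _ _ => Polynomial.monic_X_sub_C _).mul
      (Polynomial.monic_prod_of_monic _ _ fun _ _ => Polynomial.monic_X_sub_C _)
  have hsplit (f : Fin n → Polynomial F) : ∏ j, f j = (∏ l, f (w l)) * ∏ j ∈ S, f j := by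
    rw [hS, ← Finset.prod_map univ w f, Finset.prod_mul_prod_compl]
  have hN : (hallLittlewoodNum x t r).map (MvPolynomial.eval (x ∘ w)) =
      e * ∏ j ∈ S, (Polynomial.X - Polynomial.C (t * x j)) := by
    simp only [hallLittlewoodNum, Polynomial.map_mul, Polynomial.map_prod, Polynomial.map_sub,
      Polynomial.map_X, Polynomial.map_C, MvPolynomial.eval_C, MvPolynomial.eval_X,
      Function.comp_apply]
    rw [hsplit, he]
    ring
  have hD : (hallLittlewoodDen x t r).map (MvPolynomial.eval (x ∘ w)) =
      e * ∏ j ∈ S, (Polynomial.X - Polynomial.C (x j)) := by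
    simp only [hallLittlewoodDen, Polynomial.map_mul, Polynomial.map_prod, Polynomial.map_sub,
      Polynomial.map_X, Polynomial.map_C, MvPolynomial.eval_C, MvPolynomial.eval_X,
      Function.comp_apply, map_mul (MvPolynomial.eval _)]
    rw [hsplit, he]
    ring
  rw [sum_eval_mul_prod_div_eq_coeff_divByMonic S x t hx.injOn (fun i _ => hx0 i) ht,
    mul_inv_cancel_left₀ ht, map_sub, map_mul, MvPolynomial.eval_C, hcard,
    ← Polynomial.coeff_map, ← Polynomial.coeff_map,
    Polynomial.map_divByMonic _ (hallLittlewoodDen_monic x t r), Polynomial.map_mul, hN, hD,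
    mul_left_comm, Polynomial.mul_divByMonic_mul_left hem
      (Polynomial.monic_prod_of_monic _ _ fun _ _ => Polynomial.monic_X_sub_C _)]

/-- The constant coefficient of a polynomial times the product of the Hall–Littlewood factors. -/
theorem coeff_zero_lexPoly_mul_prod {n : ℕ} (x : Fin n → F) (t : F) (hx : Function.Injective x)
    (hx0 : ∀ i, x i ≠ 0) (ht : 1 - t ≠ 0) {r : ℕ} (p : MvPolynomial (Fin r) F) :
    (lexPoly F r p * ∏ k, hallLittlewoodFactor x t r k).coeff 0 =
      (1 - t) ^ r * ∑ w : Fin r ↪ Fin n, MvPolynomial.eval (x ∘ w) p *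
        hallLittlewoodTerm x t w := by
  induction r with
  | zero =>
    obtain ⟨c, rfl⟩ := MvPolynomial.C_surjective (R := F) (Fin 0) p
    simp [lexPoly, hallLittlewoodTerm]
  | succ r ih =>
    rw [coeff_zero_lexPoly_mul_prod_succ, ih, ← (Equiv.embeddingFinSucc r (Fin n)).symm.sum_comp,
      Fintype.sum_sigma, pow_succ, mul_assoc, Finset.mul_sum (a := 1 - t)]
    congr 1
    refine Finset.sum_congr rfl fun w _ => ?_
    rw [eval_coeff_divByMonic_eq_sum x t hx hx0 ht, mul_assoc, Finset.sum_mul]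
    congr 1
    rw [Finset.sum_subtype (p := fun i => i ∉ Set.range w) _ (by simp)]
    refine Finset.sum_congr rfl fun i _ => ?_
    rw [hallLittlewoodTerm_succ, Equiv.coe_embeddingFinSucc_symm, ← mul_assoc]
    congr 2
    rw [← MvPolynomial.eval_eq_eval_mv_eval']
    congr 2
    funext k
    cases k using Fin.cases <;> rfl

end HallLittlewood

/-- The coset representatives in `C(r, n)` are determined by their first `r` values, which can be
any distinct elements. -/
theorem sum_Cperm_eq_sum_embedding {M : Type*} [AddCommMonoid M] {r n : ℕ} (hrn : r ≤ n)
    (f : (Fin r ↪ Fin n) → M) :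
    ∑ w ∈ Cperm r n, f ((Fin.castLEEmb hrn).trans w.toEmbedding) = ∑ e, f e := by
  have htail {w : Equiv.Perm (Fin n)} (hw : w ∈ Cperm r n) (S : Finset (Fin n))
      (hS : S = (univ.map ((Fin.castLEEmb hrn).trans w.toEmbedding))ᶜ) (hcard : #S = n - r)
      (k : Fin (n - r)) : w ⟨r + k, by omega⟩ = S.orderEmbOfFin hcard k := by
    have hw' := (Finset.mem_filter.1 hw).2
    have := Finset.orderEmbOfFin_unique hcard
      (f := fun k : Fin (n - r) => w ⟨r + k, by omega⟩) (fun k => ?_) (fun k l hkl => ?_)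
    · exact congrFun this k
    · rw [hS]
      simp only [Finset.mem_compl, Finset.mem_map, Finset.mem_univ, true_and, not_exists]
      intro i hi
      have := congrArg Fin.val (w.injective hi)
      have hi' := i.isLt
      simp at this
      omega
    · exact hw' _ _ (Nat.le_add_right _ _) (Nat.add_lt_add_left hkl r)
  refine Finset.sum_bij (fun w _ => (Fin.castLEEmb hrn).trans w.toEmbedding)
    (fun _ _ => Finset.mem_univ _) (fun w hw v hv hwv => ?_) (fun e _ => ?_) fun _ _ => rfl
  · have hcard : #(univ.map ((Fin.castLEEmb hrn).trans w.toEmbedding))ᶜ = n - r := by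
      simp [Finset.card_compl]
    ext1 i
    rcases lt_or_ge (i : ℕ) r with hi | hi
    · exact DFunLike.congr_fun hwv (⟨i, hi⟩ : Fin r)
    · have h := (htail hw _ rfl hcard ⟨i - r, by omega⟩).trans
        (htail hv _ (by rw [hwv]) hcard ⟨i - r, by omega⟩).symm
      simpa only [Nat.add_sub_cancel' hi] using h
  · have hcard : #(univ.map e)ᶜ = n - r := by simp [Finset.card_compl]
    have hmem (k : Fin (n - r)) (i : Fin r) : e i ≠ (univ.map e)ᶜ.orderEmbOfFin hcard k := by
      intro h
      have := Finset.orderEmbOfFin_mem _ hcard k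
      rw [← h] at this
      simp at this
    let g : Fin n → Fin n := fun i =>
      if h : (i : ℕ) < r then e ⟨i, h⟩ else
        (univ.map e)ᶜ.orderEmbOfFin hcard ⟨i - r, by omega⟩
    have hg : Function.Injective g := by
      intro i j hij
      simp only [g] at hij
      split_ifs at hij with hi hj hj
      · exact Fin.ext (congrArg Fin.val (e.injective hij) :)
      · exact absurd hij (hmem _ _)
      · exact absurd hij.symm (hmem _ _)
      · have := congrArg Fin.val (((univ.map e)ᶜ.orderEmbOfFin hcard).injective hij)
        simp only at this
        exact Fin.ext (by omega)
    refine ⟨Equiv.ofBijective g (Finite.injective_iff_bijective.1 hg), ?_, ?_⟩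
    · refine Finset.mem_filter.2 ⟨Finset.mem_univ _, fun i j hi hij => ?_⟩
      have hj : r ≤ (j : ℕ) := hi.trans hij.le
      simp only [Equiv.ofBijective_apply, g, dif_neg (not_lt.2 hi), dif_neg (not_lt.2 hj)]
      refine ((univ.map e)ᶜ.orderEmbOfFin hcard).strictMono ?_
      rw [Fin.lt_def] at hij ⊢
      simp only
      omega
    · ext i
      simp [g]

/-- Reversing the order of the chosen variables. -/
theorem prod_prod_Ioi_eq_hallLittlewoodTerm {F : Type*} [Field F] {n r : ℕ} (hrn : r ≤ n)
    (x : Fin n → F) (t : F) (w : Equiv.Perm (Fin n)) :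
    ∏ i : Fin r, ∏ j ∈ Ioi (Fin.castLE hrn i),
        (x (w (Fin.castLE hrn i)) - t * x (w j)) / (x (w (Fin.castLE hrn i)) - x (w j)) =
      hallLittlewoodTerm x t
        (Fin.revPerm.toEmbedding.trans ((Fin.castLEEmb hrn).trans w.toEmbedding)) := by
  rw [hallLittlewoodTerm, ← Equiv.prod_comp Fin.revPerm]
  refine Finset.prod_congr rfl fun k _ => ?_
  refine (Finset.prod_map (Ioi (Fin.castLE hrn k.rev)) w.toEmbedding fun j =>
    (x (w (Fin.castLE hrn k.rev)) - t * x j) / (x (w (Fin.castLE hrn k.rev)) - x j)).symm.trans ?_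
  refine Finset.prod_congr ?_ fun _ _ => rfl
  ext j
  obtain ⟨j, rfl⟩ := w.surjective j
  simp only [Finset.mem_Ioi, Finset.mem_compl,
    Finset.mem_map, Finset.mem_Ici, not_exists, not_and, Function.Embedding.trans_apply,
    Equiv.coe_toEmbedding, Fin.revPerm_apply, Fin.castLEEmb_apply, w.injective.eq_iff,
    Fin.lt_def, Fin.le_def, Fin.ext_iff, Fin.val_castLE, Fin.val_rev]
  have hk := k.isLt
  constructor
  · intro h l hl
    omega
  · intro h
    refine ⟨j, ?_, rfl⟩
    by_contra hlt
    have := h ⟨r - 1 - j, by omega⟩ (by simp only; omega)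
    simp only at this
    omega

theorem lexVar_inv {F : Type*} [Field F] {r : ℕ} (k : Fin r) :
    (lexVar F r k)⁻¹ = HahnSeries.single (toLex (Pi.single k (1 : ℤ))) 1 := by
  refine inv_eq_of_mul_eq_one_left ?_
  rw [lexVar, HahnSeries.single_mul_single, mul_one, ← toLex_add, ← Pi.single_add]
  simp

theorem prod_lexVar_inv_pow {F : Type*} [Field F] {r : ℕ} (m : Fin r → ℕ) :
    ∏ k, ((lexVar F r k)⁻¹) ^ m k = HahnSeries.single (toLex fun k => (m k : ℤ)) 1 := by
  have h (s : Finset (Fin r)) : ∏ k ∈ s, ((lexVar F r k)⁻¹) ^ m k =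
      HahnSeries.single (∑ k ∈ s, m k • toLex (Pi.single k (1 : ℤ))) 1 := by
    induction s using Finset.induction_on with
    | empty => simp
    | insert a s ha ih =>
      rw [Finset.prod_insert ha, Finset.sum_insert ha, ih, lexVar_inv, HahnSeries.single_pow,
        HahnSeries.single_mul_single, one_pow, mul_one]
  rw [h]
  refine congrArg (fun a => HahnSeries.single a (1 : F)) ?_
  change ∑ k, m k • (Pi.single k (1 : ℤ) : Fin r → ℤ) = fun k => (m k : ℤ)
  ext k
  simp [Finset.sum_apply, Pi.single_apply]

/-- **Generating function for the factorial Hall–Littlewood `P`-polynomials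
(additive specialization of the universal factorial Hall–Littlewood `P`-functions).**

For a partition `λ_1 ≥ ⋯ ≥ λ_r > 0` of length `r ≤ n`,
`HP_λ(x_n;t|b) = Σ_{w∈C(r,n)} w·( ∏_i ∏_{j=1}^{λ_i} (x_i+b_j)
  · ∏_i ∏_{j=i+1}^n (x_i−tx_j)/(x_i−x_j) )`
equals the coefficient of `u_1^{−λ_1}⋯u_r^{−λ_r}` in
`(1−t)^{−r} ∏_i ( ∏_{j=1}^n (u_i−tx_j)/(u_i−x_j) · ∏_{j=1}^{i−1} (u_i−u_j)/(u_i−tu_j)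
  − t^{n−i+1} ) · ∏_i ∏_{j=1}^{λ_i} (u_i+b_j)/u_i`. -/
theorem factorial_hall_littlewood_P_generating_function
    (n r : ℕ) (hr : 1 ≤ r) (hrn : r ≤ n)
    (lam : Fin r → ℕ) (hpos : ∀ i, 0 < lam i)
    (hanti : ∀ i j : Fin r, i ≤ j → lam j ≤ lam i) :
    (∑ w ∈ Cperm r n,
      (∏ i : Fin r, ∏ j ∈ Finset.range (lam i), (x n (w (Fin.castLE hrn i)) + b n j)) *
      (∏ i : Fin r, ∏ j ∈ Finset.Ioi (Fin.castLE hrn i),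
          (x n (w (Fin.castLE hrn i)) - t n * x n (w j)) /
          (x n (w (Fin.castLE hrn i)) - x n (w j))))
    =
    ((((1 - HahnSeries.C (t n) : H n r) ^ r)⁻¹) *
      (∏ i : Fin r,
        ((∏ j : Fin n,
            (u n r i - HahnSeries.C (t n) * HahnSeries.C (x n j)) /
            (u n r i - HahnSeries.C (x n j))) *
         (∏ j ∈ Finset.Iio i,
            (u n r i - u n r j) / (u n r i - HahnSeries.C (t n) * u n r j)) -
         HahnSeries.C (t n) ^ (n - (i : ℕ)))) *
      (∏ i : Fin r, ∏ j ∈ Finset.range (lam i),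
          (u n r i + HahnSeries.C (b n j)) / u n r i)).coeff
        (toLex (fun k : Fin r => (lam (Fin.rev k) : ℤ))) := by
  have hx : Function.Injective (x n) := fun i j hij =>
    Sum.inl_injective (MvPolynomial.X_injective (IsFractionRing.injective _ _ hij))
  have hx0 (i : Fin n) : x n i ≠ 0 := fun h =>
    MvPolynomial.X_ne_zero _ ((map_eq_zero_iff _ (IsFractionRing.injective _ _)).1 h)
  have ht : 1 - t n ≠ 0 := by
    intro h
    rw [sub_eq_zero, t, ← map_one (algebraMap (MvPolynomial (Fin n ⊕ ℕ ⊕ Unit) ℚ) (K n))] at h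
    have := congrArg (MvPolynomial.eval 0) (IsFractionRing.injective _ _ h)
    simp at this
  set p : MvPolynomial (Fin r) (K n) :=
    ∏ k, ∏ j ∈ range (lam (Fin.rev k)), (MvPolynomial.X k + MvPolynomial.C (b n j)) with hp
  have hpoly : ∏ i : Fin r, ∏ j ∈ Finset.range (lam i),
      (u n r i + HahnSeries.C (b n j)) / u n r i =
        lexPoly (K n) r p * HahnSeries.single (toLex fun k : Fin r => (lam (Fin.rev k) : ℤ)) 1 := by
    rw [← prod_lexVar_inv_pow fun k => lam (Fin.rev k), hp, map_prod, ← Finset.prod_mul_distrib,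
      ← Equiv.prod_comp Fin.revPerm]
    refine Finset.prod_congr rfl fun k _ => ?_
    have hk : u n r (Fin.rev k) = lexVar (K n) r k := by rw [u, Fin.rev_rev, lexVar]
    have hX : lexPoly (K n) r (MvPolynomial.X k) = lexVar (K n) r k := by simp [lexPoly]
    have hC (c : K n) : lexPoly (K n) r (MvPolynomial.C c) = HahnSeries.C c := by
      simp [lexPoly, -HahnSeries.C_apply]
    simp only [Fin.revPerm_apply, hk, map_prod, map_add, hX, hC, div_eq_mul_inv,
      Finset.prod_mul_distrib, Finset.prod_const, Finset.card_range]
  have hfactor : ∏ i : Fin r,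
        ((∏ j : Fin n,
            (u n r i - HahnSeries.C (t n) * HahnSeries.C (x n j)) /
            (u n r i - HahnSeries.C (x n j))) *
         (∏ j ∈ Finset.Iio i,
            (u n r i - u n r j) / (u n r i - HahnSeries.C (t n) * u n r j)) -
         HahnSeries.C (t n) ^ (n - (i : ℕ))) =
      ∏ k, hallLittlewoodFactor (x n) (t n) r k := by
    rw [← Equiv.prod_comp Fin.revPerm (hallLittlewoodFactor (x n) (t n) r)]
    refine Finset.prod_congr rfl fun i _ => ?_
    rw [Fin.revPerm_apply, hallLittlewoodFactor, Fin.rev_rev, ← Fin.map_revPerm_Iio,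
      Finset.prod_map]
    rfl
  have hinv : (((1 - HahnSeries.C (t n) : H n r) ^ r)⁻¹) = HahnSeries.C (((1 - t n) ^ r)⁻¹) := by
    rw [map_inv₀, map_pow, map_sub, map_one]
  rw [hpoly, hfactor, hinv, ← mul_assoc, HahnSeries.coeff_mul_single, mul_one, sub_self, mul_assoc,
    HahnSeries.C_apply, HahnSeries.coeff_single_zero_mul, mul_comm (∏ k, _),
    coeff_zero_lexPoly_mul_prod (x n) (t n) hx hx0 ht,
    inv_mul_cancel_left₀ (pow_ne_zero r ht),
    ← (Fin.revPerm.embeddingCongr (Equiv.refl (Fin n))).sum_comp,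
    ← sum_Cperm_eq_sum_embedding hrn]
  refine Finset.sum_congr rfl fun w _ => ?_
  rw [prod_prod_Ioi_eq_hallLittlewoodTerm, hp, map_prod, ← Equiv.prod_comp Fin.revPerm]
  congr 1
  refine Finset.prod_congr rfl fun k _ => ?_
  simp
end
end

section
/- Let λ = (λ_1 ≥ ⋯ ≥ λ_r > 0) be a partition of length r ≤ n and define the factorial Hall–Littlewood Q-polynomial HQ_λ(x_n;t|b) := Σ_{w∈C(r,n)} w·( ∏_{i=1}^{r} (1−t) x_i ∏_{j=1}^{λ_i−1} (x_i + b_j) · ∏_{i=1}^{r} ∏_{j=i+1}^{n} (x_i − t x_j)/(x_i − x_j) ). Then HQ_λ(x_n;t|b) = [u_1^{−λ_1}⋯u_r^{−λ_r}]( ∏_{i=1}^{r} ( ∏_{j=1}^{n} (u_i − t x_j)/(u_i − x_j) · ∏_{j=1}^{λ_i−1} (u_i + b_j)/u_i ) · ∏_{1≤i<j≤r} (u_j − u_i)/(u_j − t u_i) ), the coefficient being taken in Λ. This is the additive specialization of the generating-function theorem for the universal factorial Hall–Littlewood Q-functions. -/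
open Finset

noncomputable section

namespace HahnSeries

variable {Γ F : Type*} [AddCommGroup Γ] [LinearOrder Γ] [IsOrderedAddMonoid Γ] [Field F]

/-- The subring of Hahn series whose support lies in an additive submonoid of the exponents. -/
def supportedIn (F : Type*) [Field F] (N : AddSubmonoid Γ) : Subring (HahnSeries Γ F) where
  carrier := {f | ∀ g, f.coeff g ≠ 0 → g ∈ N}
  mul_mem' {f g} hf hg k hk := by
    obtain ⟨a, ha, c, hc, rfl⟩ := support_mul_subset (mem_support _ _ |>.2 hk)
    exact N.add_mem (hf a ha) (hg c hc)
  one_mem' k hk := by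
    rw [coeff_one] at hk
    split_ifs at hk with h
    · exact h ▸ N.zero_mem
    · exact absurd rfl hk
  add_mem' {f g} hf hg k hk := by
    by_cases h : f.coeff k = 0
    · exact hg k fun h' => hk (by simp [h, h'])
    · exact hf k h
  zero_mem' k hk := absurd (coeff_zero) hk
  neg_mem' {f} hf k hk := hf k fun h => hk (by simp [h])

theorem supportedIn_mono {M N : AddSubmonoid Γ} (h : M ≤ N) :
    supportedIn F M ≤ supportedIn F N := fun _ hf g hg => h (hf g hg)

theorem coeff_eq_zero_of_mem_supportedIn {N : AddSubmonoid Γ} {f : HahnSeries Γ F}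
    (hf : f ∈ supportedIn F N) {g : Γ} (hg : g ∉ N) : f.coeff g = 0 :=
  by_contra fun h => hg (hf g h)

theorem single_mem_supportedIn {N : AddSubmonoid Γ} {g : Γ} (hg : g ∈ N) (c : F) :
    single g c ∈ supportedIn F N := fun k hk => by
  by_cases h : k = g
  · exact h ▸ hg
  · exact absurd (coeff_single_of_ne h) hk

theorem C_mem_supportedIn (N : AddSubmonoid Γ) (c : F) :
    (C c : HahnSeries Γ F) ∈ supportedIn F N :=
  single_mem_supportedIn N.zero_mem c

theorem one_sub_single_mul_hsum_powers {g : Γ} (hg : 0 < g) (c : F) :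
    (1 - single g c) * (SummableFamily.powers (single g c)).hsum = 1 :=
  SummableFamily.one_sub_self_mul_hsum_powers
    ((WithTop.coe_lt_coe.2 hg).trans_le orderTop_single_le)

theorem one_sub_single_ne_zero {g : Γ} (hg : 0 < g) (c : F) : (1 - single g c) ≠ 0 :=
  left_ne_zero_of_mul_eq_one (one_sub_single_mul_hsum_powers hg c)

theorem inv_one_sub_single_mem_supportedIn {N : AddSubmonoid Γ} {g : Γ} (hg : 0 < g) (hgN : g ∈ N)
    (c : F) : (1 - single g c)⁻¹ ∈ supportedIn F N := by
  rw [inv_eq_of_mul_eq_one_right (one_sub_single_mul_hsum_powers hg c)]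
  intro k hk
  obtain ⟨m, hm⟩ := Set.mem_iUnion.1 (SummableFamily.support_hsum_subset hk)
  rw [SummableFamily.powers_of_orderTop_pos
    ((WithTop.coe_lt_coe.2 hg).trans_le orderTop_single_le)] at hm
  exact pow_mem (single_mem_supportedIn hgN c) m k hm

theorem single_sub_single_eq (g h : Γ) (c : F) :
    (single (-g) 1 - single (-h) c : HahnSeries Γ F) =
      single (-g) 1 * (1 - single (g - h) c) := by
  rw [mul_sub, mul_one, single_mul_single, one_mul]
  congr 3
  abel

theorem single_sub_single_ne_zero {g h : Γ} (hgh : h < g) (c : F) :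
    (single (-g) 1 - single (-h) c : HahnSeries Γ F) ≠ 0 := by
  rw [single_sub_single_eq]
  exact mul_ne_zero (single_ne_zero one_ne_zero) (one_sub_single_ne_zero (sub_pos.2 hgh) c)

theorem inv_single_sub_single_mem_supportedIn {N : AddSubmonoid Γ} {g h : Γ} (hgh : h < g)
    (hg : g ∈ N) (hghN : g - h ∈ N) (c : F) :
    (single (-g) 1 - single (-h) c : HahnSeries Γ F)⁻¹ ∈ supportedIn F N := by
  rw [single_sub_single_eq, mul_inv, inv_single, neg_neg]
  exact mul_mem (single_mem_supportedIn hg _)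
    (inv_one_sub_single_mem_supportedIn (sub_pos.2 hgh) hghN c)

/-- The pairs of elements of a subring that are congruent modulo multiples of `c`. -/
def congrSubring {R : Type*} [CommRing R] (S : Subring R) (c : R) : Subring (R × R) where
  carrier := {f | f.1 ∈ S ∧ f.2 ∈ S ∧ ∃ q ∈ S, f.1 - f.2 = c * q}
  mul_mem' := by
    rintro f g ⟨hf, hf', q, hq, e⟩ ⟨hg, hg', q', hq', e'⟩
    refine ⟨mul_mem hf hg, mul_mem hf' hg', f.1 * q' + q * g.2,
      add_mem (mul_mem hf hq') (mul_mem hq hg'), ?_⟩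
    simp only [Prod.fst_mul, Prod.snd_mul]
    linear_combination f.1 * e' + g.2 * e
  one_mem' := ⟨one_mem _, one_mem _, 0, zero_mem _, by simp⟩
  add_mem' := by
    rintro f g ⟨hf, hf', q, hq, e⟩ ⟨hg, hg', q', hq', e'⟩
    refine ⟨add_mem hf hg, add_mem hf' hg', q + q', add_mem hq hq', ?_⟩
    simp only [Prod.fst_add, Prod.snd_add]
    linear_combination e + e'
  zero_mem' := ⟨zero_mem _, zero_mem _, 0, zero_mem _, by simp⟩
  neg_mem' := by
    rintro f ⟨hf, hf', q, hq, e⟩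
    refine ⟨neg_mem hf, neg_mem hf', -q, neg_mem hq, ?_⟩
    simp only [Prod.fst_neg, Prod.snd_neg]
    linear_combination -e

theorem diag_mem_congrSubring {R : Type*} [CommRing R] {S : Subring R} {a : R} (ha : a ∈ S)
    (c : R) : (a, a) ∈ congrSubring S c :=
  ⟨ha, ha, 0, zero_mem _, by simp⟩

theorem inv_mem_congrSubring {R : Type*} [Field R] {S : Subring R} {f g c : R}
    (h : (f, g) ∈ congrSubring S c) (hf : f ≠ 0) (hg : g ≠ 0) (hf' : f⁻¹ ∈ S) (hg' : g⁻¹ ∈ S) :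
    (f⁻¹, g⁻¹) ∈ congrSubring S c := by
  obtain ⟨-, -, q, hq, e⟩ := h
  refine ⟨hf', hg', -(f⁻¹ * g⁻¹ * q), neg_mem (mul_mem (mul_mem hf' hg') hq), ?_⟩
  have e : f - g = c * q := e
  change f⁻¹ - g⁻¹ = _
  have : c * -(f⁻¹ * g⁻¹ * q) = -(f⁻¹ * g⁻¹ * (c * q)) := by ring
  rw [this, ← e]
  field_simp
  ring

end HahnSeries

open Polynomial in
/-- The partial fraction decomposition of `∏ (U - t xₐ) / (U - xₐ)`. -/
theorem prod_sub_mul_div_sub_eq {L ι : Type*} [Field L] [DecidableEq ι] (A : Finset ι) (v : ι → L)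
    (hv : Function.Injective v) (t U : L) (hU : ∀ a, U ≠ v a) :
    ∏ a ∈ A, (U - t * v a) / (U - v a) = 1 + ∑ a ∈ A,
      ((1 - t) * v a * ∏ k ∈ A.erase a, (v a - t * v k) / (v a - v k)) / (U - v a) := by
  have hmon (w : ι → L) : (Lagrange.nodal A w).Monic := Lagrange.nodal_monic
  have hdeg : (Lagrange.nodal A (fun a => t * v a) - Lagrange.nodal A v).degree < #A := by
    rw [← Lagrange.degree_nodal (s := A) (v := fun a => t * v a)]
    refine degree_sub_lt_left ?_ (hmon _).ne_zero ?_
    · simp [Lagrange.degree_nodal]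
    · rw [(hmon _).leadingCoeff, (hmon _).leadingCoeff]
  have key := congrArg (eval U) (Lagrange.eq_interpolate hv.injOn hdeg)
  rw [Lagrange.eval_interpolate_not_at_node _ (fun a _ => hU a)] at key
  have hne : eval U (Lagrange.nodal A v) ≠ 0 := Lagrange.eval_nodal_not_at_node fun a _ => hU a
  have hsum : ∑ a ∈ A, Lagrange.nodalWeight A v a * (U - v a)⁻¹ *
        eval (v a) (Lagrange.nodal A (fun a => t * v a) - Lagrange.nodal A v) = ∑ a ∈ A,
      ((1 - t) * v a * ∏ k ∈ A.erase a, (v a - t * v k) / (v a - v k)) / (U - v a) := by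
    refine sum_congr rfl fun a ha => ?_
    rw [eval_sub, Lagrange.eval_nodal_at_node ha, Lagrange.eval_nodal, ← mul_prod_erase _ _ ha,
      Lagrange.nodalWeight, prod_div_distrib, prod_inv_distrib]
    ring
  rw [hsum, eval_sub] at key
  rw [prod_div_distrib, ← Lagrange.eval_nodal, ← Lagrange.eval_nodal, div_eq_iff hne]
  linear_combination key

namespace HahnSeries

variable {Γ F ι : Type*} [AddCommGroup Γ] [LinearOrder Γ] [IsOrderedAddMonoid Γ] [Field F]

/-- Extracting the coefficient of `u⁻¹`, where `u = single (-e) 1`, picks up the residues at the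
poles `u = xₐ`. The homomorphism `φ` records the degree in `u⁻¹`. -/
theorem coeff_prod_sub_mul_div_sub_mul [DecidableEq ι] (φ : Γ →+ ℤ) {e : Γ} (he : 0 < e)
    (hφe : φ e = 1) (A : Finset ι) (x : ι → F) (hx : Function.Injective x) (t : F)
    (G : HahnSeries Γ F) (Gx : ι → HahnSeries Γ F)
    (hG : G ∈ supportedIn F ((AddSubmonoid.nonneg ℤ).comap (-φ)))
    (hGx : ∀ a ∈ A, Gx a ∈ supportedIn F (AddMonoidHom.mker φ))
    (hcongr : ∀ a ∈ A, (G, Gx a) ∈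
      congrSubring (supportedIn F ((AddSubmonoid.nonneg ℤ).comap (-φ))) (single (-e) 1 - C (x a)))
    {E : Γ} (hE : φ E = 0) :
    ((∏ a ∈ A, (single (-e) 1 - C t * C (x a)) / (single (-e) 1 - C (x a))) * G).coeff (e + E) =
      ∑ a ∈ A, ((1 - t) * x a * ∏ k ∈ A.erase a, (x a - t * x k) / (x a - x k)) *
        (Gx a).coeff E := by
  have hne (a : ι) : (single (-e) 1 - C (x a) : HahnSeries Γ F) ≠ 0 := by
    simpa [C_apply] using single_sub_single_ne_zero he (x a)
  have hneg : e + E ∉ (AddSubmonoid.nonneg ℤ).comap (-φ) := by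
    simp [hφe, hE]
  rw [prod_sub_mul_div_sub_eq A (fun a => (C (x a) : HahnSeries Γ F))
    (C_injective.comp hx) (C t) _ (fun a => sub_ne_zero.1 (hne a)), add_mul, one_mul, coeff_add,
    coeff_eq_zero_of_mem_supportedIn hG hneg, zero_add, sum_mul, coeff_sum]
  refine sum_congr rfl fun a ha => ?_
  obtain ⟨-, -, q, hq, hGq⟩ := hcongr a ha
  have hGq : G - Gx a = (single (-e) 1 - C (x a)) * q := hGq
  set c := (1 - t) * x a * ∏ k ∈ A.erase a, (x a - t * x k) / (x a - x k) with hc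
  have hcC : (1 - C t) * C (x a) * ∏ k ∈ A.erase a, (C (x a) - C t * C (x k)) / (C (x a) - C (x k))
      = (C c : HahnSeries Γ F) := by
    simp only [hc, map_mul, map_sub, map_one, map_prod, map_div₀]
  have hsplit : (single (-e) 1 - C (x a) : HahnSeries Γ F)⁻¹ =
      single e 1 + single (e + e) (x a) * (1 - single e (x a))⁻¹ := by
    have h1 := one_sub_single_ne_zero he (x a)
    have h2 := single_sub_single_eq e 0 (x a)
    rw [neg_zero, sub_zero] at h2
    rw [C_apply, h2, mul_inv, inv_single, neg_neg, inv_one]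
    field_simp
    rw [mul_sub, mul_one, single_mul_single, one_mul]
    ring
  have hsp : C c / (single (-e) 1 - C (x a)) * G =
      C c * (single e 1 * Gx a) +
        (C c * (single (e + e) (x a) * ((1 - single e (x a))⁻¹ * Gx a)) + C c * q) := by
    have : G = Gx a + (single (-e) 1 - C (x a)) * q := by rw [← hGq]; ring
    rw [this, mul_add, ← mul_assoc (C c / _), div_mul_cancel₀ _ (hne a), div_eq_mul_inv, hsplit]
    ring
  have hpos : (1 - single e (x a))⁻¹ * Gx a ∈ supportedIn F ((AddSubmonoid.nonneg ℤ).comap φ) := by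
    refine mul_mem (inv_one_sub_single_mem_supportedIn he (by simp [hφe]) _)
      (supportedIn_mono ?_ (hGx a ha))
    intro g hg
    have hg : φ g = 0 := hg
    simp [hg]
  have hnot : e + E - (e + e) ∉ (AddSubmonoid.nonneg ℤ).comap φ := by
    simp [hφe, hE]
  rw [hcC, hsp, coeff_add, coeff_add, C_apply, coeff_single_zero_mul, coeff_single_zero_mul,
    coeff_single_zero_mul, coeff_single_mul, coeff_single_mul,
    coeff_eq_zero_of_mem_supportedIn hq hneg, coeff_eq_zero_of_mem_supportedIn hpos hnot]
  simp

end HahnSeries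

section

variable {F ι : Type*} [Field F] [DecidableEq ι]

/-- The sum of `∏ i, g i (A \ {f 0, …, f i}) (f i)` over injective sequences `f` in `A`. -/
def sequenceSum : (m : ℕ) → (Fin m → Finset ι → ι → F) → Finset ι → F
  | 0, _, _ => 1
  | m + 1, g, A =>
    ∑ a ∈ A, g 0 (A.erase a) a * sequenceSum m (fun i => g i.succ) (A.erase a)

theorem sequenceSum_eq [Fintype ι] (m : ℕ) (g : Fin m → Finset ι → ι → F) (A : Finset ι) :
    sequenceSum m g A = ∑ f : Fin m → ι with Function.Injective f ∧ ∀ i, f i ∈ A,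
      ∏ i, g i (A \ (Iic i).image f) (f i) := by
  induction m generalizing A with
  | zero => simp [sequenceSum, Function.injective_of_subsingleton]
  | succ m ih =>
    rw [sequenceSum, sum_filter, ← (Fin.consEquiv fun _ => ι).sum_comp, Fintype.sum_prod_type,
      ← sum_filter_add_sum_filter_not univ (· ∈ A)]
    rw [sum_eq_zero (s := univ.filter fun a => ¬ a ∈ A), add_zero, filter_mem_eq_inter, univ_inter]
    · refine sum_congr rfl fun a ha => ?_
      rw [ih, sum_filter, mul_sum]
      refine sum_congr rfl fun f _ => ?_
      have hiff : (Function.Injective (Fin.cons a f : Fin (m + 1) → ι) ∧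
          ∀ i, (Fin.cons a f : Fin (m + 1) → ι) i ∈ A) ↔
          (Function.Injective f ∧ ∀ i, f i ∈ A.erase a) := by
        rw [Fin.cons_injective_iff, Fin.forall_fin_succ]
        simp only [Fin.cons_zero, Fin.cons_succ, mem_erase, Set.mem_range, not_exists]
        grind
      rw [mul_ite, mul_zero]
      refine if_congr hiff.symm ?_ rfl
      change _ = ∏ i, g i (A \ (Iic i).image (Fin.cons a f : Fin (m + 1) → ι))
        ((Fin.cons a f : Fin (m + 1) → ι) i)
      rw [Fin.prod_univ_succ]
      have h0 : A \ (Iic (0 : Fin (m + 1))).image (Fin.cons a f : Fin (m + 1) → ι) = A.erase a := by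
        ext y
        simp only [mem_sdiff, mem_image, mem_Iic, Fin.exists_fin_succ, Fin.cons_zero,
          Fin.cons_succ, mem_erase]
        simp
        grind
      have hs (i : Fin m) : A \ (Iic i.succ).image (Fin.cons a f : Fin (m + 1) → ι) =
          A.erase a \ (Iic i).image f := by
        ext y
        simp only [mem_sdiff, mem_image, mem_Iic, Fin.exists_fin_succ, Fin.cons_zero,
          Fin.cons_succ, mem_erase, Fin.succ_le_succ_iff]
        simp
        grind
      simp only [h0, hs, Fin.cons_zero, Fin.cons_succ]
    · intro a ha
      refine sum_eq_zero fun f _ => if_neg fun h => ?_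
      exact (mem_filter.1 ha).2 (by simpa using h.2 0)

end

theorem univ_sdiff_image_castLE {r n : ℕ} (hrn : r ≤ n) (w : Equiv.Perm (Fin n)) (i : Fin r) :
    (univ \ (Iic i).image fun k => w (Fin.castLE hrn k)) =
      (Ioi (Fin.castLE hrn i)).map w.toEmbedding := by
  ext y
  obtain ⟨k, rfl⟩ := w.surjective y
  simp only [mem_sdiff, mem_univ, true_and, mem_image, mem_Iic, w.injective.eq_iff, mem_map,
    Equiv.coe_toEmbedding, mem_Ioi, exists_eq_right, not_exists, not_and]
  constructor
  · intro h
    by_contra hk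
    rw [not_lt] at hk
    have hk' : (k : ℕ) ≤ i := hk
    exact h ⟨k, hk'.trans_lt i.2⟩ hk (Fin.ext rfl)
  · rintro h j hj rfl
    exact absurd (lt_of_lt_of_le h (show Fin.castLE hrn j ≤ Fin.castLE hrn i from hj)) (lt_irrefl _)

/-- A permutation in `Cperm r n` is determined by its first `r` values. -/
theorem Cperm_injOn {r n : ℕ} (hrn : r ≤ n) :
    Set.InjOn (fun (w : Equiv.Perm (Fin n)) (i : Fin r) => w (Fin.castLE hrn i)) (Cperm r n) := by
  obtain ⟨d, rfl⟩ := Nat.exists_eq_add_of_le hrn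
  intro w hw w' hw' h
  have hmono {w : Equiv.Perm (Fin (r + d))} (hw : w ∈ Cperm r (r + d)) :
      StrictMono fun i : Fin d => w (Fin.natAdd r i) := fun i j hij =>
    (mem_filter.1 hw).2 _ _ (by simp) (by simpa using hij)
  have hrange (w : Equiv.Perm (Fin (r + d))) : Set.range (fun i : Fin d => w (Fin.natAdd r i)) =
      (Set.range fun i : Fin r => w (Fin.castLE hrn i))ᶜ := by
    ext y
    obtain ⟨k, rfl⟩ := w.surjective y
    refine Fin.addCases (fun k => ?_) (fun k => ?_) k
    · simp [Fin.ext_iff]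
      omega
    · simp [Fin.ext_iff]
      omega
  have h2 := ((hmono hw).range_inj (hmono hw')).1 (by
    rw [hrange, hrange]
    exact congrArg (fun f => (Set.range f)ᶜ) h)
  ext1 k
  refine Fin.addCases (fun k => congrFun h k) (fun k => congrFun h2 k) k

theorem exists_mem_Cperm {r n : ℕ} (hrn : r ≤ n) (f : Fin r → Fin n) (hf : Function.Injective f) :
    ∃ w ∈ Cperm r n, (fun i : Fin r => w (Fin.castLE hrn i)) = f := by
  obtain ⟨d, rfl⟩ := Nat.exists_eq_add_of_le hrn
  have hcard : #(univ.image f)ᶜ = d := by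
    rw [card_compl, card_image_of_injective _ hf]
    simp
  set g := (univ.image f)ᶜ.orderEmbOfFin hcard with hg
  have hgf (i : Fin d) (j : Fin r) : g i ≠ f j := fun h => by
    have := orderEmbOfFin_mem (univ.image f)ᶜ hcard i
    rw [← hg, h] at this
    simp at this
  have hinj : Function.Injective (Fin.append f g) :=
    Fin.append_injective_iff.2 ⟨hf, g.injective, fun i j => (hgf j i).symm⟩
  refine ⟨Equiv.ofBijective _ (Finite.injective_iff_bijective.1 hinj), ?_, ?_⟩
  · rw [Cperm, mem_filter]
    refine ⟨mem_univ _, fun i j hi hij => ?_⟩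
    induction i using Fin.addCases with
    | left i => simp at hi; omega
    | right i =>
      induction j using Fin.addCases with
      | left j => simp [Fin.lt_def] at hij; omega
      | right j => simpa using hij
  · funext i
    exact Fin.append_left f g i

theorem sum_Cperm_eq {M : Type*} [AddCommMonoid M] {r n : ℕ} (hrn : r ≤ n)
    (φ : (Fin r → Fin n) → M) :
    ∑ w ∈ Cperm r n, φ (fun i => w (Fin.castLE hrn i)) =
      ∑ f : Fin r → Fin n with Function.Injective f, φ f := by
  refine sum_bij (fun w _ i => w (Fin.castLE hrn i)) ?_ ?_ ?_ ?_
  · intro w _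
    exact mem_filter.2 ⟨mem_univ _, w.injective.comp (Fin.castLE_injective hrn)⟩
  · exact fun w hw w' hw' h => Cperm_injOn hrn hw hw' h
  · intro f hf
    obtain ⟨w, hw, h⟩ := exists_mem_Cperm hrn f (mem_filter.1 hf).2
    exact ⟨w, hw, h⟩
  · exact fun _ _ => rfl

namespace HahnSeries

variable {F ι : Type*} [Field F] {r : ℕ}

theorem mul_mem_congrSubring {R : Type*} [CommRing R] {S : Subring R} {c f f' g g' : R}
    (hf : (f, f') ∈ congrSubring S c) (hg : (g, g') ∈ congrSubring S c) :
    (f * g, f' * g') ∈ congrSubring S c :=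
  mul_mem hf hg

theorem add_mem_congrSubring {R : Type*} [CommRing R] {S : Subring R} {c f f' g g' : R}
    (hf : (f, f') ∈ congrSubring S c) (hg : (g, g') ∈ congrSubring S c) :
    (f + g, f' + g') ∈ congrSubring S c :=
  add_mem hf hg

theorem sub_mem_congrSubring {R : Type*} [CommRing R] {S : Subring R} {c f f' g g' : R}
    (hf : (f, f') ∈ congrSubring S c) (hg : (g, g') ∈ congrSubring S c) :
    (f - g, f' - g') ∈ congrSubring S c :=
  sub_mem hf hg

theorem prod_mem_congrSubring {R κ : Type*} [CommRing R] {S : Subring R} {c : R} {s : Finset κ}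
    {f g : κ → R} (h : ∀ k ∈ s, (f k, g k) ∈ congrSubring S c) :
    (∏ k ∈ s, f k, ∏ k ∈ s, g k) ∈ congrSubring S c := by
  have : (∏ k ∈ s, f k, ∏ k ∈ s, g k) = ∏ k ∈ s, (f k, g k) := by
    ext <;> simp [Prod.fst_prod, Prod.snd_prod]
  exact this ▸ prod_mem h

/-- The exponent vector of the variable in position `p`. -/
def unitExponent (p : Fin r) : Lex (Fin r → ℤ) := toLex (Pi.single p 1)

/-- The coordinate of an exponent vector in position `p`. -/
def exponentCoord (p : Fin r) : Lex (Fin r → ℤ) →+ ℤ where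
  toFun g := ofLex g p
  map_zero' := rfl
  map_add' _ _ := rfl

theorem exponent_ext {g h : Lex (Fin r → ℤ)} (H : ∀ p, exponentCoord p g = exponentCoord p h) :
    g = h := funext H

theorem exponentCoord_self (p : Fin r) : exponentCoord p (unitExponent p) = 1 :=
  Pi.single_eq_same p 1

theorem exponentCoord_of_ne {p q : Fin r} (h : p ≠ q) : exponentCoord p (unitExponent q) = 0 :=
  Pi.single_eq_of_ne h 1

theorem unitExponent_lt {p q : Fin r} (h : p < q) : unitExponent q < unitExponent p :=
  ⟨p, fun j hj => by simp [unitExponent, hj.ne, (hj.trans h).ne],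
    by simp [unitExponent, h.ne]⟩

theorem unitExponent_pos (p : Fin r) : 0 < unitExponent p :=
  ⟨p, fun j hj => show (0 : ℤ) = Pi.single (M := fun _ => ℤ) p 1 j by simp [hj.ne],
    show (0 : ℤ) < Pi.single (M := fun _ => ℤ) p 1 p by simp⟩

/-- The variable in position `p`, of exponent `-1`. -/
def variableAt (F : Type*) [Field F] (p : Fin r) : HahnSeries (Lex (Fin r → ℤ)) F :=
  single (-unitExponent p) 1

theorem inv_variableAt (p : Fin r) : (variableAt F p)⁻¹ = single (unitExponent p) 1 := by
  rw [variableAt, inv_single, neg_neg, inv_one]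

theorem C_mul_variableAt (c : F) (p : Fin r) :
    C c * variableAt F p = single (-unitExponent p) c := by
  rw [variableAt, C_apply, single_mul_single, zero_add, mul_one]

theorem variableAt_sub_C_ne_zero (p : Fin r) (c : F) : variableAt F p - C c ≠ 0 := by
  simpa [variableAt, C_apply] using single_sub_single_ne_zero (unitExponent_pos p) c

theorem variableAt_sub_C_mul_ne_zero {p q : Fin r} (h : p < q) (c : F) :
    variableAt F p - C c * variableAt F q ≠ 0 := by
  rw [C_mul_variableAt]
  exact single_sub_single_ne_zero (unitExponent_lt h) c

variable {N : AddSubmonoid (Lex (Fin r → ℤ))}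

theorem variableAt_mem {p : Fin r} (h : -unitExponent p ∈ N) : variableAt F p ∈ supportedIn F N :=
  single_mem_supportedIn h 1

theorem inv_variableAt_mem {p : Fin r} (h : unitExponent p ∈ N) :
    (variableAt F p)⁻¹ ∈ supportedIn F N :=
  inv_variableAt (F := F) p ▸ single_mem_supportedIn h 1

theorem inv_variableAt_sub_C_mem {p : Fin r} (h : unitExponent p ∈ N) (c : F) :
    (variableAt F p - C c)⁻¹ ∈ supportedIn F N := by
  simpa [variableAt, C_apply] using
    inv_single_sub_single_mem_supportedIn (unitExponent_pos p) h (by simpa) c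

theorem inv_variableAt_sub_C_mul_mem {p q : Fin r} (h : p < q) (hp : unitExponent p ∈ N)
    (hpq : unitExponent p - unitExponent q ∈ N) (c : F) :
    (variableAt F p - C c * variableAt F q)⁻¹ ∈ supportedIn F N := by
  rw [C_mul_variableAt]
  exact inv_single_sub_single_mem_supportedIn (unitExponent_lt h) hp hpq c

/-- The generating series in the variables in positions `p i`. -/
def generatingSeries {m : ℕ} (x : ι → F) (t : F) (b : ℕ → F) (p : Fin m → Fin r) (lam : Fin m → ℕ)
    (A : Finset ι) : HahnSeries (Lex (Fin r → ℤ)) F :=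
  (∏ i, ((∏ a ∈ A, (variableAt F (p i) - C t * C (x a)) / (variableAt F (p i) - C (x a))) *
    ∏ j ∈ range (lam i - 1), (variableAt F (p i) + C (b j)) / variableAt F (p i))) *
  ∏ i, ∏ j ∈ Ioi i, (variableAt F (p j) - variableAt F (p i)) /
    (variableAt F (p j) - C t * variableAt F (p i))

/-- The factor by which removing the variable in position `p 0` multiplies the remaining generating
series, as a function of the value of that variable. -/
def removalFactor {m : ℕ} (t : F) (b : ℕ → F) (p : Fin (m + 1) → Fin r) (k : ℕ)
    (y : HahnSeries (Lex (Fin r → ℤ)) F) : HahnSeries (Lex (Fin r → ℤ)) F :=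
  (∏ j ∈ range k, (y + C (b j))) *
    ∏ i : Fin m, (variableAt F (p i.succ) - y) / (variableAt F (p i.succ) - C t * y)

theorem generatingSeries_succ {m : ℕ} (x : ι → F) (t : F) (b : ℕ → F) (p : Fin (m + 1) → Fin r)
    (lam : Fin (m + 1) → ℕ) (A : Finset ι) :
    generatingSeries x t b p lam A = single ((lam 0 - 1) • unitExponent (p 0)) 1 *
      ((∏ a ∈ A, (single (-unitExponent (p 0)) 1 - C t * C (x a)) /
          (single (-unitExponent (p 0)) 1 - C (x a))) *
        (removalFactor t b p (lam 0 - 1) (variableAt F (p 0)) *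
          generatingSeries x t b (fun i => p i.succ) (fun i => lam i.succ) A)) := by
  have hpow : (variableAt F (p 0) ^ (lam 0 - 1))⁻¹ =
      single ((lam 0 - 1) • unitExponent (p 0)) 1 := by
    rw [← inv_pow, inv_variableAt, single_pow, one_pow]
  rw [generatingSeries, generatingSeries, removalFactor, Fin.prod_univ_succ,
    Fin.prod_univ_succ (f := fun i => ∏ j ∈ Ioi i, _), Fin.prod_Ioi_zero,
    prod_div_distrib (f := fun j => variableAt F (p 0) + C (b j)), prod_const, card_range,
    div_eq_mul_inv _ (variableAt F (p 0) ^ (lam 0 - 1)), hpow]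
  simp only [Fin.prod_Ioi_succ, variableAt]
  ring

theorem generatingSeries_mem {m : ℕ} (x : ι → F) (t : F) (b : ℕ → F) {p : Fin m → Fin r}
    (hp : StrictAnti p) (lam : Fin m → ℕ) (A : Finset ι)
    {N : AddSubgroup (Lex (Fin r → ℤ))} (hN : ∀ i, unitExponent (p i) ∈ N) :
    generatingSeries x t b p lam A ∈ supportedIn F N.toAddSubmonoid := by
  have hu (i : Fin m) : variableAt F (p i) ∈ supportedIn F N.toAddSubmonoid :=
    variableAt_mem (N.neg_mem (hN i))
  have hC := C_mem_supportedIn (F := F) N.toAddSubmonoid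
  simp only [generatingSeries, div_eq_mul_inv]
  refine mul_mem (prod_mem fun i _ => mul_mem (prod_mem fun a _ => ?_) (prod_mem fun j _ => ?_))
    (prod_mem fun i _ => prod_mem fun j hj => ?_)
  · exact mul_mem (sub_mem (hu i) (mul_mem (hC _) (hC _))) (inv_variableAt_sub_C_mem (hN i) _)
  · exact mul_mem (add_mem (hu i) (hC _)) (inv_variableAt_mem (hN i))
  · exact mul_mem (sub_mem (hu j) (hu i)) (inv_variableAt_sub_C_mul_mem (hp (mem_Ioi.1 hj)) (hN j)
      (N.sub_mem (hN j) (hN i)) t)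

theorem removalFactor_C_mem {m : ℕ} (t : F) (b : ℕ → F) (p : Fin (m + 1) → Fin r) (k : ℕ) (y : F)
    {N : AddSubgroup (Lex (Fin r → ℤ))} (hN : ∀ i : Fin m, unitExponent (p i.succ) ∈ N) :
    removalFactor t b p k (C y) ∈ supportedIn F N.toAddSubmonoid := by
  have hC := C_mem_supportedIn (F := F) N.toAddSubmonoid
  simp only [removalFactor, div_eq_mul_inv]
  refine mul_mem (prod_mem fun j _ => add_mem (hC _) (hC _)) (prod_mem fun i _ => ?_)
  rw [← map_mul]
  exact mul_mem (sub_mem (variableAt_mem (N.neg_mem (hN i))) (hC _))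
    (inv_variableAt_sub_C_mem (hN i) _)

theorem removalFactor_congr {m : ℕ} (t : F) (b : ℕ → F) {p : Fin (m + 1) → Fin r}
    (hp : StrictAnti p) (k : ℕ) (y : F) {N : AddSubmonoid (Lex (Fin r → ℤ))}
    (hN : ∀ i : Fin m, unitExponent (p i.succ) ∈ N)
    (hN' : ∀ i : Fin m, -unitExponent (p i.succ) ∈ N) (h0 : -unitExponent (p 0) ∈ N) :
    (removalFactor t b p k (variableAt F (p 0)), removalFactor t b p k (C y)) ∈
      congrSubring (supportedIn F N) (variableAt F (p 0) - C y) := by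
  have hC := C_mem_supportedIn (F := F) N
  have hy : (variableAt F (p 0), C y) ∈
      congrSubring (supportedIn F N) (variableAt F (p 0) - C y) :=
    ⟨variableAt_mem h0, hC y, 1, one_mem _, (mul_one _).symm⟩
  have hu (i : Fin m) : variableAt F (p i.succ) ∈ supportedIn F N := variableAt_mem (hN' i)
  simp only [removalFactor, div_eq_mul_inv]
  refine mul_mem_congrSubring (prod_mem_congrSubring fun j _ => add_mem_congrSubring
      hy (diag_mem_congrSubring (hC _) _))
    (prod_mem_congrSubring fun i _ =>
      mul_mem_congrSubring (sub_mem_congrSubring (diag_mem_congrSubring (hu i) _) hy)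
        (inv_mem_congrSubring (sub_mem_congrSubring (diag_mem_congrSubring (hu i) _)
          (mul_mem_congrSubring (diag_mem_congrSubring (hC t) _) hy))
        (variableAt_sub_C_mul_ne_zero (hp i.succ_pos) t) ?_
        (inv_variableAt_sub_C_mul_mem (hp i.succ_pos) (hN i) ?_ t) ?_))
  · rw [← map_mul]
    exact variableAt_sub_C_ne_zero _ _
  · rw [sub_eq_add_neg]
    exact N.add_mem (hN i) h0
  · rw [← map_mul]
    exact inv_variableAt_sub_C_mem (hN i) _

variable [DecidableEq ι]

theorem removalFactor_mul_generatingSeries {m : ℕ} (x : ι → F) (t : F) (b : ℕ → F)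
    (p : Fin (m + 1) → Fin r) (k : ℕ) (lam : Fin m → ℕ) {A : Finset ι} {a : ι} (ha : a ∈ A) :
    removalFactor t b p k (C (x a)) * generatingSeries x t b (fun i => p i.succ) lam A =
      C (∏ j ∈ range k, (x a + b j)) *
        generatingSeries x t b (fun i => p i.succ) lam (A.erase a) := by
  have hfac (i : Fin m) :
      (∏ c ∈ A.erase a, (variableAt F (p i.succ) - C t * C (x c)) /
        (variableAt F (p i.succ) - C (x c))) =
      (variableAt F (p i.succ) - C (x a)) / (variableAt F (p i.succ) - C t * C (x a)) *
        ∏ c ∈ A, (variableAt F (p i.succ) - C t * C (x c)) /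
          (variableAt F (p i.succ) - C (x c)) := by
    have h1 := variableAt_sub_C_ne_zero (p i.succ) (x a)
    have h2 := variableAt_sub_C_ne_zero (p i.succ) (t * x a)
    rw [map_mul] at h2
    rw [← mul_prod_erase A _ ha, ← mul_assoc, div_mul_div_cancel₀ h2, div_self h1, one_mul]
  simp only [removalFactor, generatingSeries, hfac, map_prod, map_add, prod_mul_distrib]
  ring

theorem coeff_generatingSeries (x : ι → F) (hx : Function.Injective x) (t : F) (b : ℕ → F)
    (m : ℕ) (p : Fin m → Fin r) (hp : StrictAnti p) (lam : Fin m → ℕ) (hpos : ∀ i, 0 < lam i)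
    (A : Finset ι) :
    (generatingSeries x t b p lam A).coeff (∑ i, lam i • unitExponent (p i)) =
      sequenceSum m (fun i B a => (1 - t) * x a * (∏ j ∈ range (lam i - 1), (x a + b j)) *
        ∏ k ∈ B, (x a - t * x k) / (x a - x k)) A := by
  induction m generalizing A with
  | zero => simp [generatingSeries, sequenceSum]
  | succ m ih =>
    have hp' : StrictAnti fun i : Fin m => p i.succ := fun i j h => hp (Fin.succ_lt_succ_iff.2 h)
    have hcoord (i : Fin m) : exponentCoord (p 0) (unitExponent (p i.succ)) = 0 :=
      exponentCoord_of_ne (hp i.succ_pos).ne'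
    have hexp : (∑ i, lam i • unitExponent (p i)) - (lam 0 - 1) • unitExponent (p 0) =
        unitExponent (p 0) + ∑ i : Fin m, lam i.succ • unitExponent (p i.succ) := by
      obtain ⟨k, hk⟩ := Nat.exists_eq_succ_of_ne_zero (hpos 0).ne'
      rw [Fin.sum_univ_succ, hk, Nat.succ_sub_one, succ_nsmul]
      abel
    have hker (i : Fin m) : unitExponent (p i.succ) ∈ (exponentCoord (p 0)).ker := hcoord i
    have hle : (exponentCoord (p 0)).ker.toAddSubmonoid ≤
        (AddSubmonoid.nonneg ℤ).comap (-exponentCoord (p 0)) := fun g hg => by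
      have hg : exponentCoord (p 0) g = 0 := hg
      simp [hg]
    have hrest := generatingSeries_mem x t b hp' (fun i => lam i.succ) A hker
    rw [generatingSeries_succ, coeff_single_mul, one_mul, hexp,
      coeff_prod_sub_mul_div_sub_mul (exponentCoord (p 0)) (unitExponent_pos _)
        (exponentCoord_self _) A x hx t _
        (fun a => removalFactor t b p (lam 0 - 1) (C (x a)) *
          generatingSeries x t b (fun i => p i.succ) (fun i => lam i.succ) A),
      sequenceSum]
    · refine sum_congr rfl fun a ha => ?_
      rw [removalFactor_mul_generatingSeries x t b p _ _ ha, C_apply, coeff_single_zero_mul,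
        ih _ hp' _ (fun i => hpos i.succ)]
      ring
    · have := removalFactor_congr t b hp (lam 0 - 1) 0 (fun i => hle (hker i))
        (fun i => hle ((exponentCoord (p 0)).ker.neg_mem (hker i))) (by simp [exponentCoord_self])
      exact mul_mem this.1 (supportedIn_mono hle hrest)
    · exact fun a _ => mul_mem (removalFactor_C_mem t b p _ _ hker) hrest
    · exact fun a _ => mul_mem_congrSubring (removalFactor_congr t b hp _ _ (fun i => hle (hker i))
        (fun i => hle ((exponentCoord (p 0)).ker.neg_mem (hker i))) (by simp [exponentCoord_self]))
        (diag_mem_congrSubring (supportedIn_mono hle hrest) _)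
    · rw [map_sum]
      exact sum_eq_zero fun i _ => by rw [map_nsmul, hcoord, smul_zero]

end HahnSeries

theorem u_eq_variableAt (n r : ℕ) (i : Fin r) : u n r i = HahnSeries.variableAt (K n) i.rev := by
  rw [u, HahnSeries.variableAt, HahnSeries.unitExponent, ← toLex_neg, ← Pi.single_neg]

theorem x_injective (n : ℕ) : Function.Injective (x n) :=
  (IsFractionRing.injective _ _).comp ((MvPolynomial.X_injective).comp Sum.inl_injective)

/-- **Generating function for the factorial Hall–Littlewood `Q`-polynomials
(additive specialization of the universal factorial Hall–Littlewood `Q`-functions).**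

For a partition `λ_1 ≥ ⋯ ≥ λ_r > 0` of length `r ≤ n`,
`HQ_λ(x_n;t|b) = Σ_{w∈C(r,n)} w·( ∏_i (1−t)x_i ∏_{j=1}^{λ_i−1} (x_i+b_j)
  · ∏_i ∏_{j=i+1}^n (x_i−tx_j)/(x_i−x_j) )`
equals the coefficient of `u_1^{−λ_1}⋯u_r^{−λ_r}` in
`∏_i ( ∏_{j=1}^n (u_i−tx_j)/(u_i−x_j) · ∏_{j=1}^{λ_i−1} (u_i+b_j)/u_i )
  · ∏_{1≤i<j≤r} (u_j−u_i)/(u_j−tu_i)`. -/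
theorem factorial_hall_littlewood_Q_generating_function
    (n r : ℕ) (hr : 1 ≤ r) (hrn : r ≤ n)
    (lam : Fin r → ℕ) (hpos : ∀ i, 0 < lam i)
    (hanti : ∀ i j : Fin r, i ≤ j → lam j ≤ lam i) :
    (∑ w ∈ Cperm r n,
      (∏ i : Fin r, ((1 - t n) * x n (w (Fin.castLE hrn i)) *
          ∏ j ∈ Finset.range (lam i - 1), (x n (w (Fin.castLE hrn i)) + b n j))) *
      (∏ i : Fin r, ∏ j ∈ Finset.Ioi (Fin.castLE hrn i),
          (x n (w (Fin.castLE hrn i)) - t n * x n (w j)) /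
          (x n (w (Fin.castLE hrn i)) - x n (w j))))
    =
    ((∏ i : Fin r,
        ((∏ j : Fin n,
            (u n r i - HahnSeries.C (t n) * HahnSeries.C (x n j)) /
            (u n r i - HahnSeries.C (x n j))) *
         (∏ j ∈ Finset.range (lam i - 1),
            (u n r i + HahnSeries.C (b n j)) / u n r i))) *
      (∏ i : Fin r, ∏ j ∈ Finset.Ioi i,
          (u n r j - u n r i) / (u n r j - HahnSeries.C (t n) * u n r i))).coeff
        (toLex (fun k : Fin r => (lam (Fin.rev k) : ℤ))) := by

  have hexp : toLex (fun k : Fin r => (lam (Fin.rev k) : ℤ)) =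
      ∑ i, lam i • HahnSeries.unitExponent i.rev := by
    refine HahnSeries.exponent_ext fun k => ?_
    rw [map_sum, sum_eq_single k.rev]
    · rw [map_nsmul, Fin.rev_rev, HahnSeries.exponentCoord_self, nsmul_one]
      rfl
    · intro i _ hi
      rw [map_nsmul, HahnSeries.exponentCoord_of_ne fun h => hi (by rw [h, Fin.rev_rev]), smul_zero]
    · exact fun h => absurd (mem_univ _) h
  have key := HahnSeries.coeff_generatingSeries (x n) (x_injective n) (t n) (b n) r Fin.rev
    Fin.rev_strictAnti lam hpos univ
  rw [← hexp, HahnSeries.generatingSeries] at key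
  simp only [u_eq_variableAt]
  rw [key, sequenceSum_eq]
  simp only [mem_univ, implies_true, and_true]
  rw [← sum_Cperm_eq hrn]
  refine sum_congr rfl fun w _ => ?_
  rw [← prod_mul_distrib]
  refine prod_congr rfl fun i _ => ?_
  rw [univ_sdiff_image_castLE, prod_map]
  rfl
end
end
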